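/- Let φ₀ : 𝔻 → 𝔻 be holomorphic with φ₀(0) = 0 and sup_{ζ∈𝔻} (1−|ζ|²)|φ₀′(ζ)| = 1, and let λ ∈ ℂ with |λ| = 1. Define φ : 𝔻² → 𝔻² by φ(z₁,z₂) = (λz₁, φ₀(z₂)). Then C_φ is an isometry on the Bloch space of 𝔻²: for every Bloch function f on 𝔻², f∘φ is Bloch and ‖f∘φ‖_B = ‖f‖_B. -/

import Mathlib

open Complex Metric Set

/-- The unit polydisk `𝔻ⁿ = { z ∈ ℂⁿ : |z_k| < 1 for all k }`. -/
def polydisk (n : ℕ) : Set (Fin n → ℂ) := {z | ∀ k, ‖z k‖ < 1}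

/-- The Bergman metric on the polydisk: `H_z(u,ū) = Σ_k |u_k|²/(1−|z_k|²)²`. -/
noncomputable def polyH (n : ℕ) (z u : Fin n → ℂ) : ℝ :=
  ∑ k, ‖u k‖ ^ 2 / (1 - ‖z k‖ ^ 2) ^ 2

/-- `Q_f(z) = sup_{u ≠ 0} |f'(z)u| / H_z(u,ū)^{1/2}` on the polydisk. -/
noncomputable def Qpoly (n : ℕ) (f : (Fin n → ℂ) → ℂ) (z : Fin n → ℂ) : ℝ :=
  sSup {r : ℝ | ∃ u : Fin n → ℂ, u ≠ 0 ∧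
    r = ‖fderiv ℂ f z u‖ / Real.sqrt (polyH n z u)}

/-- The set of values `Q_f(z)` for `z ∈ 𝔻ⁿ`. -/
def blochValuesPoly (n : ℕ) (f : (Fin n → ℂ) → ℂ) : Set ℝ :=
  {r : ℝ | ∃ z ∈ polydisk n, r = Qpoly n f z}

/-- The Bloch seminorm `β_f = sup_{z ∈ 𝔻ⁿ} Q_f(z)`. -/
noncomputable def blochSemiPoly (n : ℕ) (f : (Fin n → ℂ) → ℂ) : ℝ :=
  sSup (blochValuesPoly n f)

/-- `f` is a Bloch function on the polydisk. -/
def IsBlochPoly (n : ℕ) (f : (Fin n → ℂ) → ℂ) : Prop :=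
  DifferentiableOn ℂ f (polydisk n) ∧ BddAbove (blochValuesPoly n f)

/-- The Bloch norm `‖f‖_B = |f(0)| + β_f` on the polydisk. -/
noncomputable def blochNormPoly (n : ℕ) (f : (Fin n → ℂ) → ℂ) : ℝ :=
  ‖f 0‖ + blochSemiPoly n f

open Filter Topology ComplexConjugate

/-- The disk automorphism. -/
noncomputable def mob (a z : ℂ) : ℂ := (z + a) / (1 + conj a * z)

lemma mob_den_ne {a z : ℂ} (ha : ‖a‖ < 1) (hz : ‖z‖ < 1) : 1 + conj a * z ≠ 0 := by
  intro h
  have h1 : conj a * z = -1 := by linear_combination h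
  have h2 : ‖a‖ * ‖z‖ = 1 := by
    have := congrArg norm h1
    simpa using this
  nlinarith [norm_nonneg a, norm_nonneg z]

lemma mob_norm_lt {a z : ℂ} (ha : ‖a‖ < 1) (hz : ‖z‖ < 1) : ‖mob a z‖ < 1 := by
  have hne := mob_den_ne ha hz
  rw [mob, norm_div, div_lt_one (norm_pos_iff.mpr hne)]
  apply lt_of_pow_lt_pow_left₀ 2 (norm_nonneg _)
  have ha2 : ‖a‖ ^ 2 < 1 := by nlinarith [norm_nonneg a]
  have hz2 : ‖z‖ ^ 2 < 1 := by nlinarith [norm_nonneg z]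
  rw [← Complex.normSq_eq_norm_sq] at ha2 hz2 ⊢
  rw [← Complex.normSq_eq_norm_sq]
  simp only [Complex.normSq_apply, Complex.add_re, Complex.add_im, Complex.mul_re, Complex.mul_im,
    Complex.conj_re, Complex.conj_im, Complex.one_re, Complex.one_im] at *
  nlinarith [mul_pos (sub_pos.mpr ha2) (sub_pos.mpr hz2)]

lemma mob_hasDerivAt {a z : ℂ} (ha : ‖a‖ < 1) (hz : ‖z‖ < 1) :
    HasDerivAt (mob a) ((1 - conj a * a) / (1 + conj a * z) ^ 2) z := by
  have hne := mob_den_ne ha hz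
  have h1 : HasDerivAt (fun z : ℂ => z + a) 1 z := (hasDerivAt_id z).add_const a
  have h2 : HasDerivAt (fun z : ℂ => 1 + conj a * z) (conj a * 1) z :=
    ((hasDerivAt_id z).const_mul (conj a)).const_add 1
  have := h1.div h2 hne
  refine this.congr_deriv ?_
  congr 1
  ring

lemma conj_mul_self' (a : ℂ) : conj a * a = ((‖a‖ ^ 2 : ℝ) : ℂ) := by
  rw [mul_comm, Complex.mul_conj, Complex.normSq_eq_norm_sq]

lemma diffAt_ball {g : ℂ → ℂ} (hd : DifferentiableOn ℂ g (ball 0 1)) {z : ℂ} (hz : ‖z‖ < 1) :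
    DifferentiableAt ℂ g z :=
  hd.differentiableAt (isOpen_ball.mem_nhds (by simpa using hz))

/-- Normalised function: for `g` a self-map, `mob (-(g 0)) ∘ g`. -/
lemma norm_comp {g : ℂ → ℂ} (hd : ∀ z, ‖z‖ < 1 → DifferentiableAt ℂ g z)
    (hm : ∀ z, ‖z‖ < 1 → ‖g z‖ < 1) :
    (∀ z, ‖z‖ < 1 → DifferentiableAt ℂ (mob (-(g 0)) ∘ g) z) ∧
    (∀ z, ‖z‖ < 1 → ‖(mob (-(g 0)) ∘ g) z‖ < 1) ∧ (mob (-(g 0)) ∘ g) 0 = 0 ∧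
    deriv (mob (-(g 0)) ∘ g) 0 = deriv g 0 / ((1 - ‖g 0‖ ^ 2 : ℝ) : ℂ) := by
  have h00 : ‖(0:ℂ)‖ < 1 := by simp
  have ha : ‖-(g 0)‖ < 1 := by simpa using hm 0 h00
  refine ⟨fun z hz => ?_, fun z hz => mob_norm_lt ha (hm z hz), by simp [mob], ?_⟩
  · exact (mob_hasDerivAt ha (hm z hz)).differentiableAt.comp z (hd z hz)
  · have h1 := (mob_hasDerivAt ha (hm 0 h00)).comp 0 (hd 0 h00).hasDerivAt
    rw [h1.deriv]
    have hpos : (1 - ‖g 0‖ ^ 2 : ℝ) ≠ 0 := by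
      have := hm 0 h00
      have : 0 < 1 - ‖g 0‖ ^ 2 := by nlinarith [norm_nonneg (g 0)]
      exact this.ne'
    have hposC : ((1 - ‖g 0‖ ^ 2 : ℝ) : ℂ) ≠ 0 := by exact_mod_cast hpos
    have e1 : 1 - conj (-(g 0)) * (-(g 0)) = ((1 - ‖g 0‖ ^ 2 : ℝ) : ℂ) := by
      rw [conj_mul_self']; simp
    have e2 : 1 + conj (-(g 0)) * (g 0) = ((1 - ‖g 0‖ ^ 2 : ℝ) : ℂ) := by
      rw [← e1]; ring
    rw [e1, e2]
    field_simp

lemma schwarz_pick_zero {g : ℂ → ℂ} (hd : ∀ z, ‖z‖ < 1 → DifferentiableAt ℂ g z)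
    (hm : ∀ z, ‖z‖ < 1 → ‖g z‖ < 1) : ‖deriv g 0‖ ≤ 1 - ‖g 0‖ ^ 2 := by
  obtain ⟨h1, h2, h3, h4⟩ := norm_comp hd hm
  have h5 : ‖deriv (mob (-(g 0)) ∘ g) 0‖ ≤ 1 := by
    apply Complex.norm_deriv_le_one_of_mapsTo_ball (R := 1) _ _ one_pos
    · intro z hz
      exact (h1 z (by simpa using hz)).differentiableWithinAt
    · intro z hz
      rw [h3]
      simpa using (h2 z (by simpa using hz)).le
  have hpos : 0 < 1 - ‖g 0‖ ^ 2 := by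
    have := hm 0 (by simp)
    nlinarith [norm_nonneg (g 0)]
  rw [h4, norm_div, Complex.norm_real, Real.norm_of_nonneg hpos.le, div_le_one hpos] at h5
  exact h5

lemma mob_zero (a : ℂ) : mob a 0 = a := by simp [mob]

lemma schwarz_pick {g : ℂ → ℂ} (hd : ∀ z, ‖z‖ < 1 → DifferentiableAt ℂ g z)
    (hm : ∀ z, ‖z‖ < 1 → ‖g z‖ < 1) {z : ℂ} (hz : ‖z‖ < 1) :
    (1 - ‖z‖ ^ 2) * ‖deriv g z‖ ≤ 1 - ‖g z‖ ^ 2 := by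
  have h := schwarz_pick_zero (g := g ∘ mob z)
    (fun w hw => (hd _ (mob_norm_lt hz hw)).comp w (mob_hasDerivAt hz hw).differentiableAt)
    (fun w hw => hm _ (mob_norm_lt hz hw))
  have hpos : 0 < 1 - ‖z‖ ^ 2 := by nlinarith [norm_nonneg z]
  have h00 : ‖(0:ℂ)‖ < 1 := by simp
  have hg : HasDerivAt g (deriv g z) (mob z 0) := by
    rw [mob_zero]; exact (hd z hz).hasDerivAt
  have h1 := hg.comp 0 (mob_hasDerivAt hz h00)
  rw [h1.deriv, conj_mul_self'] at h
  simp only [Function.comp, mob_zero, mul_zero, add_zero, one_pow, div_one, norm_mul] at h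
  rw [show (1 - ((‖z‖ ^ 2 : ℝ) : ℂ)) = ((1 - ‖z‖ ^ 2 : ℝ) : ℂ) by push_cast; ring,
    Complex.norm_real, Real.norm_of_nonneg hpos.le] at h
  linarith

lemma near_id {g : ℂ → ℂ} (hd : ∀ z, ‖z‖ < 1 → DifferentiableAt ℂ g z)
    (hm : ∀ z, ‖z‖ < 1 → ‖g z‖ < 1) {c : ℝ} (hc : 0 < c) (hgc : deriv g 0 = c)
    {w : ℂ} (hw : ‖w‖ < 1) :
    ‖g w - w‖ ≤ 2 * Real.sqrt (1 - c) + 3 * (1 - c) / (1 - ‖w‖) := by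
  obtain ⟨h1, h2, h3, h4⟩ := norm_comp hd hm
  have hsp := schwarz_pick_zero hd hm
  rw [hgc, Complex.norm_real, Real.norm_of_nonneg hc.le] at hsp
  set a := g 0 with ha_def
  have ha : ‖a‖ < 1 := hm 0 (by simp)
  set h := mob (-a) ∘ g with hh
  have hpos : 0 < 1 - ‖a‖ ^ 2 := by nlinarith [norm_nonneg a]
  set d : ℝ := c / (1 - ‖a‖ ^ 2) with hd_def
  have hd0 : 0 < d := by positivity
  have hd1 : d ≤ 1 := by rw [hd_def, div_le_one hpos]; exact hsp
  have hcd : c ≤ d := by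
    rw [hd_def, le_div_iff₀ hpos]; nlinarith [sq_nonneg ‖a‖]
  have hdO : DifferentiableOn ℂ h (ball 0 1) := fun z hz =>
    (h1 z (by simpa using hz)).differentiableWithinAt
  have hmO : MapsTo h (ball 0 1) (closedBall (h 0) 1) := fun z hz => by
    rw [h3]
    simpa using (h2 z (by simpa using hz)).le
  set k := dslope h 0 with hk
  have hk0 : k 0 = d := by
    rw [hk, dslope_same, h4, hgc, hd_def]; push_cast; rfl
  have hk1 : ∀ z, ‖z‖ < 1 → ‖k z‖ ≤ 1 := fun z hz => by
    have := Complex.norm_dslope_le_div_of_mapsTo_ball hdO hmO (z := z) (by simpa using hz)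
    simpa using this
  have hkd : DifferentiableOn ℂ k (ball 0 1) :=
    (Complex.differentiableOn_dslope (ball_mem_nhds _ one_pos)).mpr hdO
  have hhw : h w = w * k w := by
    have := sub_smul_dslope h 0 w
    rw [h3] at this
    simpa using this.symm
  -- Schwarz-Pick for t * k
  have key : ∀ t : ℝ, 0 < t → t < 1 →
      ‖(t:ℂ) * k w - t * d‖ ≤ ‖w‖ * ‖1 - (t * d : ℂ) * (t * k w)‖ := by
    intro t ht0 ht1
    have hq := norm_comp (g := fun z => (t:ℂ) * k z)
      (fun z hz => (diffAt_ball hkd hz).const_mul _)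
      (fun z hz => by
        rw [norm_mul, Complex.norm_real, Real.norm_of_nonneg ht0.le]
        nlinarith [hk1 z hz, norm_nonneg (k z)])
    obtain ⟨q1, q2, q3, -⟩ := hq
    have := Complex.norm_le_norm_of_mapsTo_ball (R := 1)
      (fun z hz => (q1 z (by simpa using hz)).differentiableWithinAt)
      (fun z hz => by simpa using (q2 z (by simpa using hz)).le) q3 hw
    have hne : 1 + conj (-((t:ℂ) * k 0)) * (t * k w) ≠ 0 := by
      apply mob_den_ne
      · rw [norm_neg, norm_mul, Complex.norm_real, Real.norm_of_nonneg ht0.le]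
        nlinarith [hk1 0 (by simp), norm_nonneg (k 0)]
      · rw [norm_mul, Complex.norm_real, Real.norm_of_nonneg ht0.le]
        nlinarith [hk1 w hw, norm_nonneg (k w)]
    simp only [Function.comp, mob] at this
    rw [norm_div, div_le_iff₀ (norm_pos_iff.mpr hne), hk0] at this
    simp only [map_neg, map_mul, Complex.conj_ofReal] at this
    rw [show (1:ℂ) - (t * d : ℂ) * (t * k w) = 1 + -((t:ℂ) * d) * (t * k w) by ring,
      sub_eq_add_neg]
    exact this
  have key1 : ‖k w - d‖ ≤ ‖w‖ * ‖1 - (d : ℂ) * (k w)‖ := by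
    have c1 : Tendsto (fun t : ℝ => ‖(t:ℂ) * k w - t * d‖) (𝓝[<] 1)
        (𝓝 ‖((1:ℝ):ℂ) * k w - (1:ℝ) * d‖) := by
      apply Tendsto.mono_left _ nhdsWithin_le_nhds
      apply Continuous.tendsto
      fun_prop
    have c2 : Tendsto (fun t : ℝ => ‖w‖ * ‖1 - (t * d : ℂ) * (t * k w)‖) (𝓝[<] 1)
        (𝓝 (‖w‖ * ‖1 - ((1:ℝ) * d : ℂ) * ((1:ℝ) * k w)‖)) := by
      apply Tendsto.mono_left _ nhdsWithin_le_nhds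
      apply Continuous.tendsto (f := fun t : ℝ => ‖w‖ * ‖1 - (t * d : ℂ) * (t * k w)‖)
      fun_prop
    have := le_of_tendsto_of_tendsto c1 c2 (by
      filter_upwards [Ioo_mem_nhdsLT (zero_lt_one (α := ℝ))] with t ht
      exact key t ht.1 ht.2)
    simpa using this
  have key2 : ‖1 - (d : ℂ) * (k w)‖ ≤ (1 - d ^ 2) + ‖k w - d‖ := by
    have e : 1 - (d : ℂ) * (k w) = ((1 - d ^ 2 : ℝ) : ℂ) - d * (k w - d) := by push_cast; ring
    rw [e]
    refine (norm_sub_le _ _).trans ?_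
    rw [norm_mul, Complex.norm_real, Complex.norm_real, Real.norm_of_nonneg hd0.le,
      Real.norm_of_nonneg (by nlinarith)]
    nlinarith [norm_nonneg (k w - d)]
  have hr := norm_nonneg w
  have hr1 : 0 < 1 - ‖w‖ := by linarith
  have key3 : ‖k w - d‖ ≤ 2 * (1 - c) / (1 - ‖w‖) := by
    rw [le_div_iff₀ hr1]
    have : ‖k w - d‖ ≤ ‖w‖ * ((1 - d ^ 2) + ‖k w - d‖) :=
      key1.trans (mul_le_mul_of_nonneg_left key2 hr)
    have h6 : ‖w‖ * (1 - d ^ 2) ≤ 1 * (1 - d ^ 2) :=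
      mul_le_mul_of_nonneg_right hw.le (by nlinarith)
    nlinarith
  have hgw := hm w hw
  have key4 : ‖g w - h w‖ ≤ 2 * ‖a‖ := by
    have hne : 1 + conj (-a) * g w ≠ 0 := mob_den_ne (by simpa using ha) hgw
    have e : g w - h w = a - h w * conj a * g w := by
      have : h w * (1 + conj (-a) * g w) = g w + -a := by
        simp only [hh, Function.comp, mob]
        exact div_mul_cancel₀ _ hne
      simp only [map_neg] at this
      linear_combination -this
    rw [e]
    refine (norm_sub_le _ _).trans ?_
    rw [norm_mul, norm_mul, RCLike.norm_conj]
    have : ‖h w‖ * ‖a‖ * ‖g w‖ ≤ 1 * ‖a‖ * 1 := by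
      gcongr
      exact (h2 w hw).le
    linarith
  have key5 : ‖a‖ ≤ Real.sqrt (1 - c) := Real.le_sqrt_of_sq_le (by linarith)
  have key6 : ‖h w - w‖ ≤ ‖k w - d‖ + (1 - c) := by
    have e : h w - w = w * ((k w - d) - ((1 - d : ℝ) : ℂ)) := by rw [hhw]; push_cast; ring
    rw [e, norm_mul]
    have : ‖(k w - d) - ((1 - d : ℝ) : ℂ)‖ ≤ ‖k w - d‖ + (1 - d) := by
      refine (norm_sub_le _ _).trans ?_
      rw [Complex.norm_real, Real.norm_of_nonneg (by linarith)]
    nlinarith [norm_nonneg ((k w - d) - ((1 - d : ℝ) : ℂ))]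
  have key7 : 1 - c ≤ (1 - c) / (1 - ‖w‖) := by
    rw [le_div_iff₀ hr1]; nlinarith
  have e : g w - w = (g w - h w) + (h w - w) := by ring
  have e2 : 3 * (1 - c) / (1 - ‖w‖) = 2 * (1 - c) / (1 - ‖w‖) + (1 - c) / (1 - ‖w‖) := by ring
  rw [e, e2]
  refine (norm_add_le _ _).trans ?_
  linarith

/-- Uniform differential bound. -/
def DBound (C : ℝ) (f : (Fin 2 → ℂ) → ℂ) : Prop :=
  DifferentiableOn ℂ f (polydisk 2) ∧
    ∀ z ∈ polydisk 2, ∀ u, ‖fderiv ℂ f z u‖ ≤ C * Real.sqrt (polyH 2 z u)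

lemma isOpen_polydisk : IsOpen (polydisk 2) := by
  have : polydisk 2 = ⋂ k, {z : Fin 2 → ℂ | ‖z k‖ < 1} := by
    ext z; simp [polydisk]
  rw [this]
  refine isOpen_iInter_of_finite fun k => isOpen_lt (by fun_prop) (by fun_prop)

lemma polyH_nonneg (z u : Fin 2 → ℂ) : 0 ≤ polyH 2 z u :=
  Finset.sum_nonneg fun k _ => by positivity

lemma norm_le_sqrt_polyH {z : Fin 2 → ℂ} (hz : z ∈ polydisk 2) (u : Fin 2 → ℂ) :
    ‖u‖ ≤ Real.sqrt (polyH 2 z u) := by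
  rw [pi_norm_le_iff_of_nonneg (Real.sqrt_nonneg _)]
  intro k
  apply Real.le_sqrt_of_sq_le
  have h1 : ‖u k‖ ^ 2 / (1 - ‖z k‖ ^ 2) ^ 2 ≤ polyH 2 z u :=
    Finset.single_le_sum (f := fun k => ‖u k‖ ^ 2 / (1 - ‖z k‖ ^ 2) ^ 2)
      (fun k _ => by positivity) (Finset.mem_univ k)
  refine le_trans ?_ h1
  have hk := hz k
  have hp : 0 < 1 - ‖z k‖ ^ 2 := by nlinarith [norm_nonneg (z k)]
  rw [le_div_iff₀ (by positivity)]
  have : (1 - ‖z k‖ ^ 2) ^ 2 ≤ 1 := by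
    apply pow_le_one₀ hp.le; nlinarith [sq_nonneg ‖z k‖]
  nlinarith [sq_nonneg ‖u k‖]

lemma sqrt_polyH_pos {z : Fin 2 → ℂ} (hz : z ∈ polydisk 2) {u : Fin 2 → ℂ} (hu : u ≠ 0) :
    0 < Real.sqrt (polyH 2 z u) :=
  (norm_pos_iff.mpr hu).trans_le (norm_le_sqrt_polyH hz u)

lemma dbound_of_bloch {f : (Fin 2 → ℂ) → ℂ} (hf : IsBlochPoly 2 f) :
    0 ≤ blochSemiPoly 2 f ∧ DBound (blochSemiPoly 2 f) f := by
  have hQ0 : ∀ z, 0 ≤ Qpoly 2 f z := fun z => Real.sSup_nonneg (by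
    rintro r ⟨u, -, rfl⟩; positivity)
  refine ⟨Real.sSup_nonneg (by rintro r ⟨z, -, rfl⟩; exact hQ0 z), hf.1, fun z hz u => ?_⟩
  rcases eq_or_ne u 0 with rfl | hu
  · simp [polyH]
  rw [← div_le_iff₀ (sqrt_polyH_pos hz hu)]
  have h1 : ‖fderiv ℂ f z u‖ / Real.sqrt (polyH 2 z u) ≤ Qpoly 2 f z := by
    refine le_csSup ?_ ⟨u, hu, rfl⟩
    refine ⟨‖fderiv ℂ f z‖, ?_⟩
    rintro r ⟨v, hv, rfl⟩
    rw [div_le_iff₀ (sqrt_polyH_pos hz hv)]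
    exact ((fderiv ℂ f z).le_opNorm v).trans
      (mul_le_mul_of_nonneg_left (norm_le_sqrt_polyH hz v) (norm_nonneg _))
  exact h1.trans (le_csSup hf.2 ⟨z, hz, rfl⟩)

lemma bloch_of_dbound {f : (Fin 2 → ℂ) → ℂ} {C : ℝ} (hC : 0 ≤ C) (hf : DBound C f) :
    IsBlochPoly 2 f ∧ blochSemiPoly 2 f ≤ C := by
  have hQ : ∀ r ∈ blochValuesPoly 2 f, r ≤ C := by
    rintro r ⟨z, hz, rfl⟩
    apply Real.sSup_le _ hC
    rintro r ⟨u, hu, rfl⟩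
    rw [div_le_iff₀ (sqrt_polyH_pos hz hu)]
    exact hf.2 z hz u
  exact ⟨⟨hf.1, ⟨C, hQ⟩⟩, Real.sSup_le hQ hC⟩

/-- Composition with a product of self-maps of the disk preserves the bound. -/
lemma dbound_comp {f : (Fin 2 → ℂ) → ℂ} {C : ℝ} (hC : 0 ≤ C) (hf : DBound C f) {p q : ℂ → ℂ}
    (hpd : ∀ z, ‖z‖ < 1 → DifferentiableAt ℂ p z) (hpm : ∀ z, ‖z‖ < 1 → ‖p z‖ < 1)
    (hqd : ∀ z, ‖z‖ < 1 → DifferentiableAt ℂ q z) (hqm : ∀ z, ‖z‖ < 1 → ‖q z‖ < 1) :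
    DBound C (fun z => f ![p (z 0), q (z 1)]) := by
  have hin : ∀ z ∈ polydisk 2, ![p (z 0), q (z 1)] ∈ polydisk 2 := by
    intro z hz k
    fin_cases k
    · exact hpm _ (hz 0)
    · exact hqm _ (hz 1)
  have hder : ∀ z ∈ polydisk 2, HasFDerivAt (fun z : Fin 2 → ℂ => ![p (z 0), q (z 1)])
      (ContinuousLinearMap.pi ![deriv p (z 0) • ContinuousLinearMap.proj (R := ℂ) (φ := fun _ => ℂ) 0,
        deriv q (z 1) • ContinuousLinearMap.proj (R := ℂ) (φ := fun _ => ℂ) 1]) z := by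
    intro z hz
    rw [hasFDerivAt_pi]
    intro k
    fin_cases k
    · exact (hpd _ (hz 0)).hasDerivAt.comp_hasFDerivAt z
        (ContinuousLinearMap.proj (R := ℂ) (φ := fun _ : Fin 2 => ℂ) 0).hasFDerivAt
    · exact (hqd _ (hz 1)).hasDerivAt.comp_hasFDerivAt z
        (ContinuousLinearMap.proj (R := ℂ) (φ := fun _ : Fin 2 => ℂ) 1).hasFDerivAt
  have hcomp := fun z hz => HasFDerivAt.comp z
    (hf.1.differentiableAt (isOpen_polydisk.mem_nhds (hin z hz))).hasFDerivAt (hder z hz)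
  refine ⟨fun z hz => (hcomp z hz).differentiableAt.differentiableWithinAt, fun z hz u => ?_⟩
  have e : fderiv ℂ (fun z => f ![p (z 0), q (z 1)]) z = _ := (hcomp z hz).fderiv
  rw [e, ContinuousLinearMap.comp_apply]
  refine (hf.2 _ (hin z hz) _).trans (mul_le_mul_of_nonneg_left (Real.sqrt_le_sqrt ?_) hC)
  have aux : ∀ {g : ℂ → ℂ}, (∀ z, ‖z‖ < 1 → DifferentiableAt ℂ g z) →
      (∀ z, ‖z‖ < 1 → ‖g z‖ < 1) → ∀ {z : ℂ}, ‖z‖ < 1 → ∀ v : ℂ,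
      ‖deriv g z * v‖ ^ 2 / (1 - ‖g z‖ ^ 2) ^ 2 ≤ ‖v‖ ^ 2 / (1 - ‖z‖ ^ 2) ^ 2 := by
    intro g hd hm z hz v
    have h1 := schwarz_pick hd hm hz
    have h2 := hm z hz
    have hp : 0 < 1 - ‖z‖ ^ 2 := by nlinarith [norm_nonneg z]
    have hp' : 0 < 1 - ‖g z‖ ^ 2 := by nlinarith [norm_nonneg (g z)]
    rw [← div_pow, ← div_pow]
    apply pow_le_pow_left₀ (by positivity)
    rw [div_le_div_iff₀ hp' hp, norm_mul]
    nlinarith [norm_nonneg v, mul_le_mul_of_nonneg_left h1 (norm_nonneg v)]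
  simp only [polyH, Fin.sum_univ_two]
  exact add_le_add (aux hpd hpm (hz 0) (u 0)) (aux hqd hqm (hz 1) (u 1))

/-- The bound passes to pointwise limits. -/
lemma dbound_limit {f : (Fin 2 → ℂ) → ℂ} {C : ℝ} (hfd : DifferentiableOn ℂ f (polydisk 2))
    {F : ℕ → (Fin 2 → ℂ) → ℂ} (hF : ∀ n, DBound C (F n))
    (hlim : ∀ z ∈ polydisk 2, Tendsto (fun n => F n z) atTop (𝓝 (f z))) : DBound C f := by
  refine ⟨hfd, fun z hz u => ?_⟩
  apply le_of_forall_gt_imp_ge_of_dense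
  intro K hK
  have hcl : Continuous (fun t : ℂ => z + t • u) := by fun_prop
  have hz0 : z + (0:ℂ) • u = z := by simp
  have hnear : ∀ᶠ t : ℂ in 𝓝 0, z + t • u ∈ polydisk 2 :=
    hcl.continuousAt.preimage_mem_nhds (by rw [hz0]; exact isOpen_polydisk.mem_nhds hz)
  have hcont : ContinuousAt (fun t : ℂ => C * Real.sqrt (polyH 2 (z + t • u) u)) 0 := by
    refine ContinuousAt.mul continuousAt_const (Real.continuous_sqrt.continuousAt.comp ?_)
    unfold polyH
    refine tendsto_finsetSum _ fun k _ => ?_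
    refine ContinuousAt.div (f := fun _ : ℂ => ‖u k‖ ^ 2)
      (g := fun t : ℂ => (1 - ‖(z + t • u) k‖ ^ 2) ^ 2) continuousAt_const ?_ ?_
    · apply Continuous.continuousAt
      simp only [Pi.add_apply, Pi.smul_apply]
      fun_prop
    · have := hz k
      have hp : 0 < 1 - ‖z k‖ ^ 2 := by nlinarith [norm_nonneg (z k)]
      simpa using hp.ne'
  have hK' : ∀ᶠ t : ℂ in 𝓝 0, C * Real.sqrt (polyH 2 (z + t • u) u) < K :=
    hcont.eventually_lt_const (by simpa using hK)
  obtain ⟨δ, hδ, hball⟩ := Metric.eventually_nhds_iff_ball.mp (hnear.and hK')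
  have hline : ∀ t : ℂ, HasDerivAt (fun t : ℂ => z + t • u) u t := fun t => by
    simpa using ((hasDerivAt_id t).smul_const u).const_add z
  have hD : ∀ {g : (Fin 2 → ℂ) → ℂ}, DifferentiableOn ℂ g (polydisk 2) → ∀ t ∈ ball (0:ℂ) δ,
      HasDerivAt (fun t : ℂ => g (z + t • u)) (fderiv ℂ g (z + t • u) u) t := by
    intro g hg t ht
    exact (hg.differentiableAt (isOpen_polydisk.mem_nhds (hball t ht).1)).hasFDerivAt.comp_hasDerivAt
      t (hline t)
  have h0mem : (0:ℂ) ∈ ball (0:ℂ) δ := mem_ball_self hδ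
  have hlip : ∀ n, ∀ t ∈ ball (0:ℂ) δ, ‖F n (z + t • u) - F n (z + (0:ℂ) • u)‖ ≤ K * ‖t - 0‖ := by
    intro n t ht
    exact (convex_ball (0:ℂ) δ).norm_image_sub_le_of_norm_hasDerivWithin_le
      (f := fun t : ℂ => F n (z + t • u))
      (fun x hx => (hD (hF n).1 x hx).hasDerivWithinAt)
      (fun x hx => ((hF n).2 _ (hball x hx).1 u).trans (hball x hx).2.le) h0mem ht
  have hlipf : ∀ t ∈ ball (0:ℂ) δ, ‖f (z + t • u) - f (z + (0:ℂ) • u)‖ ≤ K * ‖t - 0‖ := by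
    intro t ht
    exact le_of_tendsto' ((hlim _ (hball t ht).1).sub (hlim _ (hball 0 h0mem).1)).norm
      (fun n => hlip n t ht)
  have hK0 : 0 ≤ K := (norm_nonneg _).trans (((hF 0).2 z hz u).trans hK.le)
  have := (hD hfd 0 h0mem).le_of_lip' hK0
    (Filter.mem_of_superset (ball_mem_nhds _ hδ) hlipf)
  rwa [hz0] at this

/-- Precomposing with automorphisms yields maps converging pointwise to the identity. -/
lemma exists_seq {φ₀ : ℂ → ℂ}
    (hm : ∀ z, ‖z‖ < 1 → ‖φ₀ z‖ < 1) (hd : ∀ z, ‖z‖ < 1 → DifferentiableAt ℂ φ₀ z)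
    (hβ : sSup {r : ℝ | ∃ ζ ∈ ball (0 : ℂ) 1, r = (1 - ‖ζ‖ ^ 2) * ‖deriv φ₀ ζ‖} = 1) :
    ∃ ψ : ℕ → ℂ → ℂ, (∀ n z, ‖z‖ < 1 → ‖ψ n z‖ < 1) ∧
      (∀ n z, ‖z‖ < 1 → DifferentiableAt ℂ (ψ n) z) ∧
      ∀ w, ‖w‖ < 1 → Tendsto (fun n => φ₀ (ψ n w)) atTop (𝓝 w) := by
  have hex : ∀ n : ℕ, ∃ ζ : ℂ, ‖ζ‖ < 1 ∧
      1 - 1 / ((n:ℝ) + 1) < (1 - ‖ζ‖ ^ 2) * ‖deriv φ₀ ζ‖ := by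
    intro n
    have hlt : 1 - 1 / ((n:ℝ) + 1) <
        sSup {r : ℝ | ∃ ζ ∈ ball (0 : ℂ) 1, r = (1 - ‖ζ‖ ^ 2) * ‖deriv φ₀ ζ‖} := by
      rw [hβ]
      have : 0 < 1 / ((n:ℝ) + 1) := by positivity
      linarith
    obtain ⟨r, ⟨ζ, hζ, rfl⟩, h⟩ := exists_lt_of_lt_csSup
      (Set.nonempty_of_mem (Set.mem_setOf.mpr ⟨0, mem_ball_self one_pos, rfl⟩)) hlt
    exact ⟨ζ, by simpa using hζ, h⟩
  choose ζ hζ1 hζ2 using hex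
  set c : ℕ → ℝ := fun n => (1 - ‖ζ n‖ ^ 2) * ‖deriv φ₀ (ζ n)‖ with hc
  have hc0 : ∀ n, 0 < c n := fun n => by
    refine lt_of_le_of_lt ?_ (hζ2 n)
    have : 1 / ((n:ℝ) + 1) ≤ 1 := by
      rw [div_le_one (by positivity)]
      have : (0:ℝ) ≤ n := by positivity
      linarith
    linarith
  have hc1 : ∀ n, c n ≤ 1 := fun n =>
    (schwarz_pick hd hm (hζ1 n)).trans (by nlinarith [sq_nonneg ‖φ₀ (ζ n)‖])
  have hclim : Tendsto c atTop (𝓝 1) := by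
    refine tendsto_of_tendsto_of_tendsto_of_le_of_le ?_ tendsto_const_nhds
      (fun n => (hζ2 n).le) hc1
    simpa using (tendsto_one_div_add_atTop_nhds_zero_nat (𝕜 := ℝ)).const_sub 1
  have hdne : ∀ n, deriv φ₀ (ζ n) ≠ 0 := fun n h => by
    have := hc0 n
    simp [hc, h] at this
  set e : ℕ → ℂ := fun n => ‖deriv φ₀ (ζ n)‖ / deriv φ₀ (ζ n) with he
  have he1 : ∀ n, ‖e n‖ = 1 := fun n => by
    simp only [he, norm_div, Complex.norm_real, norm_norm]
    exact div_self (norm_ne_zero_iff.mpr (hdne n))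
  have hrot : ∀ n z, ‖z‖ < 1 → ‖e n * z‖ < 1 := fun n z hz => by
    rw [norm_mul, he1, one_mul]; exact hz
  have hψm : ∀ n z, ‖z‖ < 1 → ‖mob (ζ n) (e n * z)‖ < 1 := fun n z hz =>
    mob_norm_lt (hζ1 n) (hrot n z hz)
  have hψD : ∀ n z, ‖z‖ < 1 → HasDerivAt (fun z => mob (ζ n) (e n * z))
      ((1 - conj (ζ n) * ζ n) / (1 + conj (ζ n) * (e n * z)) ^ 2 * (e n * 1)) z := fun n z hz =>
    (mob_hasDerivAt (hζ1 n) (hrot n z hz)).comp z ((hasDerivAt_id z).const_mul (e n))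
  refine ⟨fun n z => mob (ζ n) (e n * z), hψm, fun n z hz => (hψD n z hz).differentiableAt,
    fun w hw => ?_⟩
  have hbound : ∀ n, ‖φ₀ (mob (ζ n) (e n * w)) - w‖ ≤
      2 * Real.sqrt (1 - c n) + 3 * (1 - c n) / (1 - ‖w‖) := by
    intro n
    refine near_id (g := fun z => φ₀ (mob (ζ n) (e n * z)))
      (fun z hz => (hd _ (hψm n z hz)).comp z (hψD n z hz).differentiableAt)
      (fun z hz => hm _ (hψm n z hz)) (hc0 n) ?_ hw
    have h1 : HasDerivAt φ₀ (deriv φ₀ (ζ n)) (mob (ζ n) (e n * 0)) := by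
      rw [mul_zero, mob_zero]; exact (hd _ (hζ1 n)).hasDerivAt
    have h2 := h1.comp 0 (hψD n 0 (by simp))
    refine h2.deriv.trans ?_
    rw [conj_mul_self']
    simp only [he, hc]
    have := hdne n
    push_cast
    rw [mul_zero, mul_zero, add_zero, one_pow, div_one]
    field_simp
  rw [tendsto_iff_norm_sub_tendsto_zero]
  refine squeeze_zero (fun n => norm_nonneg _) hbound ?_
  have hcc : Continuous (fun x : ℝ => 2 * Real.sqrt (1 - x) + 3 * (1 - x) / (1 - ‖w‖)) := by
    fun_prop
  have := (hcc.tendsto 1).comp hclim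
  simpa [Function.comp_def] using this

/-- Let `φ₀` be a holomorphic self-map of the unit disk with `φ₀(0) = 0` and
Bloch seminorm `sup_{ζ∈𝔻}(1−|ζ|²)|φ₀'(ζ)| = 1`, and let `|λ| = 1`. Then the
self-map `φ(z₁,z₂) = (λ z₁, φ₀(z₂))` of the bidisk induces an isometric
composition operator on the Bloch space of `𝔻²`. -/
theorem isometry_of_rotation_times_extremal_symbol
    (φ₀ : ℂ → ℂ)
    (hmap : MapsTo φ₀ (ball (0 : ℂ) 1) (ball (0 : ℂ) 1))
    (hdiff : DifferentiableOn ℂ φ₀ (ball (0 : ℂ) 1))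
    (h0 : φ₀ 0 = 0)
    (hβ : sSup {r : ℝ | ∃ ζ ∈ ball (0 : ℂ) 1,
      r = (1 - ‖ζ‖ ^ 2) * ‖deriv φ₀ ζ‖} = 1)
    (lam : ℂ) (hlam : ‖lam‖ = 1)
    (φ : (Fin 2 → ℂ) → Fin 2 → ℂ)
    (hφ : ∀ z : Fin 2 → ℂ, φ z = ![lam * z 0, φ₀ (z 1)]) :
    ∀ f : (Fin 2 → ℂ) → ℂ, IsBlochPoly 2 f →
      IsBlochPoly 2 (f ∘ φ) ∧ blochNormPoly 2 (f ∘ φ) = blochNormPoly 2 f := by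
  intro f hf
  have hm : ∀ z, ‖z‖ < 1 → ‖φ₀ z‖ < 1 := fun z hz => by
    simpa using hmap (show z ∈ ball (0:ℂ) 1 by simpa using hz)
  have hd : ∀ z, ‖z‖ < 1 → DifferentiableAt ℂ φ₀ z := fun z hz => diffAt_ball hdiff hz
  have hrd : ∀ (l z : ℂ), DifferentiableAt ℂ (fun z => l * z) z := fun l z => by fun_prop
  have hrm : ∀ (l : ℂ), ‖l‖ = 1 → ∀ z : ℂ, ‖z‖ < 1 → ‖l * z‖ < 1 := fun l hl z hz => by
    rw [norm_mul, hl, one_mul]; exact hz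
  have hfφ : f ∘ φ = fun z => f ![lam * z 0, φ₀ (z 1)] := by
    funext z; simp [hφ]
  obtain ⟨hC, hB⟩ := dbound_of_bloch hf
  have h1 := dbound_comp hC hB (fun z _ => hrd lam z) (hrm lam hlam) hd hm
  rw [← hfφ] at h1
  obtain ⟨h2, h3⟩ := bloch_of_dbound hC h1
  refine ⟨h2, ?_⟩
  obtain ⟨hC', hB'⟩ := dbound_of_bloch h2
  obtain ⟨ψ, hψm, hψd, hψl⟩ := exists_seq hm hd hβ
  have hne : lam ≠ 0 := by
    rintro rfl; simp at hlam
  have h4 := fun n => dbound_comp hC' hB' (fun z _ => hrd lam⁻¹ z)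
    (hrm lam⁻¹ (by simp [hlam])) (hψd n) (hψm n)
  have h5 : DBound (blochSemiPoly 2 (f ∘ φ)) f := by
    refine dbound_limit hf.1 h4 fun z hz => ?_
    have hcf : ContinuousAt f z :=
      hf.1.continuousOn.continuousAt (isOpen_polydisk.mem_nhds hz)
    refine hcf.tendsto.comp (f := fun n => φ ![lam⁻¹ * z 0, ψ n (z 1)]) ?_
    rw [tendsto_pi_nhds]
    intro k
    fin_cases k
    · simp [hφ, hne]
    · simpa [hφ] using hψl (z 1) (hz 1)
  have h6 := (bloch_of_dbound hC' h5).2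
  have h7 : φ 0 = 0 := by
    rw [hφ]; ext k; fin_cases k <;> simp [h0]
  simp only [blochNormPoly, Function.comp_apply, h7]
  rw [le_antisymm h3 h6]
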